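/- (Theorem 5.1.) Assume the hypotheses: E is a differential field extension of K with differential constants λ, μ algebraically independent over K, Ψ ∈ M_ℓ(E) is a fundamental matrix for L − λ, and L̂ ∘ B̂ = B̂ ∘ L̂ on E^ℓ. Write f(λ,μ) = det M(L−λ, B−μ) = Σ_{i=0}^ℓ a_i(λ)·μ^i with a_i ∈ K[λ]. Then for every solution ψ ∈ E^ℓ of ψ′ = N_λ·ψ one has Σ_{i=0}^ℓ a_i(λ)·B̂^i(ψ) = 0 (a_i(λ) evaluated in E); in particular f(λ, B̂) annihilates Ψ columnwise: f(L,B)(Ψ) = 0. -/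

import Mathlib

open Matrix Polynomial Finset

/-- A derivation-like map on a commutative ring: additive and satisfying the Leibniz rule. -/
def IsDeriv {R : Type*} [CommRing R] (d : R → R) : Prop :=
  (∀ a b, d (a + b) = d a + d b) ∧ (∀ a b, d (a * b) = d a * b + a * d b)

/-- The recursively defined matrices `p_j(N)`:
`p_0(N) = 1`, `p_{j+1}(N) = p_j(N) * N + (p_j(N))'`. -/
def pMat {R : Type*} [CommRing R] (d : R → R) {l : ℕ}
    (N : Matrix (Fin l) (Fin l) R) : ℕ → Matrix (Fin l) (Fin l) R
  | 0 => 1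
  | j + 1 => pMat d N j * N + (pMat d N j).map d

/-- Entrywise derivative of a vector. -/
def dVec {R : Type*} (d : R → R) {l : ℕ} (v : Fin l → R) : Fin l → R :=
  fun i => d (v i)

/-- Entrywise derivative of a matrix. -/
def dMat {R : Type*} (d : R → R) {l : ℕ} (A : Matrix (Fin l) (Fin l) R) :
    Matrix (Fin l) (Fin l) R :=
  A.map d

/-- Action of the first-order operator `P = A₀ + A₁ D` on vectors with entries in a
differential extension `E` of `K` (with embedding `ι` and derivation `dE`). -/
def opP {K E : Type*} [CommRing K] [CommRing E] (ι : K →+* E) (dE : E → E) {l : ℕ}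
    (A0 A1 : Matrix (Fin l) (Fin l) K) (ψ : Fin l → E) : Fin l → E :=
  (A0.map ι).mulVec ψ + (A1.map ι).mulVec (dVec dE ψ)

/-- Action of the operator `Q = Σ_{j=0}^n B_j D^j` on vectors with entries in a
differential extension `E` of `K`. -/
def opQ {K E : Type*} [CommRing K] [CommRing E] (ι : K →+* E) (dE : E → E) {l : ℕ}
    (n : ℕ) (Bc : ℕ → Matrix (Fin l) (Fin l) K) (ψ : Fin l → E) : Fin l → E :=
  ∑ j ∈ Finset.range (n + 1), ((Bc j).map ι).mulVec ((dVec dE)^[j] ψ)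

/-- Columnwise action of `Q = Σ_{j=0}^n B_j D^j` on matrices. -/
def opQMat {K E : Type*} [CommRing K] [CommRing E] (ι : K →+* E) (dE : E → E) {l : ℕ}
    (n : ℕ) (Bc : ℕ → Matrix (Fin l) (Fin l) K) (Ψ : Matrix (Fin l) (Fin l) E) :
    Matrix (Fin l) (Fin l) E :=
  ∑ j ∈ Finset.range (n + 1), (Bc j).map ι * (dMat dE)^[j] Ψ

/-- The matrix `M(P,Q) = Σ_{j=0}^n B_j p_j(N)` with `N = -A₁⁻¹A₀`. -/
noncomputable def MPQ {K : Type*} [Field K] (dK : K → K) {l : ℕ}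
    (n : ℕ) (A0 A1 : Matrix (Fin l) (Fin l) K) (Bc : ℕ → Matrix (Fin l) (Fin l) K) :
    Matrix (Fin l) (Fin l) K :=
  ∑ j ∈ Finset.range (n + 1), Bc j * pMat dK (-(A1⁻¹ * A0)) j

/-- Coefficientwise extension of a derivation to polynomials (the variable is a constant). -/
noncomputable def dPoly {K : Type*} [CommRing K] (d : K → K) (p : Polynomial K) : Polynomial K :=
  p.sum fun n a => Polynomial.C (d a) * Polynomial.X ^ n

/-- `N_λ = -A₁⁻¹ (A₀ - λ·1)` as a matrix over `K[λ]`. -/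
noncomputable def Nlam {K : Type*} [Field K] {l : ℕ} (A0 A1 : Matrix (Fin l) (Fin l) K) :
    Matrix (Fin l) (Fin l) (Polynomial K) :=
  -((A1⁻¹).map (Polynomial.C : K →+* Polynomial K) *
      (A0.map (Polynomial.C : K →+* Polynomial K)
        - (Polynomial.X : Polynomial K) • (1 : Matrix (Fin l) (Fin l) (Polynomial K))))

/-- `M(L-λ, B-μ) = Σ_{j=0}^n B_j p_j(N_λ) - μ·1` as a matrix over `K[λ][μ]`
(inner variable `λ`, outer variable `μ`). -/
noncomputable def Mspec {K : Type*} [Field K] (dK : K → K) {l : ℕ}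
    (n : ℕ) (A0 A1 : Matrix (Fin l) (Fin l) K) (Bc : ℕ → Matrix (Fin l) (Fin l) K) :
    Matrix (Fin l) (Fin l) (Polynomial (Polynomial K)) :=
  (∑ j ∈ Finset.range (n + 1),
      (Bc j).map (Polynomial.C.comp Polynomial.C : K →+* Polynomial (Polynomial K)) *
        (pMat (dPoly dK) (Nlam A0 A1) j).map
          (Polynomial.C : Polynomial K →+* Polynomial (Polynomial K)))
    - (Polynomial.X : Polynomial (Polynomial K)) •
        (1 : Matrix (Fin l) (Fin l) (Polynomial (Polynomial K)))

/-- The differential resultant `f(λ,μ) = det M(L-λ, B-μ)` as an element of `K[λ][μ]`. -/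
noncomputable def fSpec {K : Type*} [Field K] (dK : K → K) {l : ℕ}
    (n : ℕ) (A0 A1 : Matrix (Fin l) (Fin l) K) (Bc : ℕ → Matrix (Fin l) (Fin l) K) :
    Polynomial (Polynomial K) :=
  (Mspec dK n A0 A1 Bc).det

/-- Evaluation `K[λ][μ] → E` at `λ = a`, `μ = b` (through `ι : K →+* E`). -/
noncomputable def evalLM {K E : Type*} [CommRing K] [CommRing E] (ι : K →+* E) (a b : E) :
    Polynomial (Polynomial K) →+* E :=
  Polynomial.eval₂RingHom (Polynomial.eval₂RingHom ι a) b

/-- `N_λ` with `λ` specialized to an element `lam` of an extension `E`. -/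
noncomputable def NlamE {K E : Type*} [Field K] [CommRing E] (ι : K →+* E) (lam : E) {l : ℕ}
    (A0 A1 : Matrix (Fin l) (Fin l) K) : Matrix (Fin l) (Fin l) E :=
  -((A1⁻¹).map ι * (A0.map ι - lam • 1))

/-- `g(L,B)` applied to `ψ`, for `g` a polynomial in two variables over `C₀`
(inner variable `λ` substituted by `Lh`, outer variable `μ` substituted by `Bh`). -/
noncomputable def applyPoly {C₀ E : Type*} [CommRing C₀] [CommRing E] (ιc : C₀ →+* E) {l : ℕ}
    (Lh Bh : (Fin l → E) → (Fin l → E)) (g : Polynomial (Polynomial C₀)) (ψ : Fin l → E) :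
    Fin l → E :=
  ∑ i ∈ Finset.range (g.natDegree + 1),
    ∑ k ∈ Finset.range ((g.coeff i).natDegree + 1),
      ιc ((g.coeff i).coeff k) • Lh^[k] (Bh^[i] ψ)

theorem IsDeriv.zero' {R : Type*} [CommRing R] {d : R → R} (h : IsDeriv d) : d 0 = 0 := by
  have := h.1 0 0
  simpa using this

theorem IsDeriv.sum' {R : Type*} [CommRing R] {d : R → R} (h : IsDeriv d) {α : Type*}
    (s : Finset α) (f : α → R) : d (∑ i ∈ s, f i) = ∑ i ∈ s, d (f i) :=
  map_sum (AddMonoidHom.mk' d h.1) f s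

theorem IsDeriv.pow_const {R : Type*} [CommRing R] {d : R → R} (h : IsDeriv d) {c : R}
    (hc : d c = 0) (k : ℕ) : d (c ^ k) = 0 := by
  induction k with
  | zero =>
    have := h.2 1 1
    simpa using this
  | succ k ih => rw [pow_succ, h.2, ih, hc]; simp

theorem dPoly_eval {K E : Type*} [Field K] [Field E] {dK : K → K} {dE : E → E}
    (hdE : IsDeriv dE) (ι : K →+* E) (hcomp : ∀ a : K, dE (ι a) = ι (dK a))
    {lam : E} (hlam : dE lam = 0) (p : Polynomial K) :
    dE (Polynomial.eval₂RingHom ι lam p) = Polynomial.eval₂RingHom ι lam (dPoly dK p) := by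
  unfold dPoly Polynomial.sum
  rw [map_sum]
  simp only [Polynomial.coe_eval₂RingHom]
  rw [Polynomial.eval₂_eq_sum, Polynomial.sum, hdE.sum']
  refine Finset.sum_congr rfl fun i _ => ?_
  rw [hdE.2, hdE.pow_const hlam, hcomp]
  simp

theorem dVec_mulVec {R : Type*} [CommRing R] {d : R → R} (h : IsDeriv d) {l : ℕ}
    (A : Matrix (Fin l) (Fin l) R) (v : Fin l → R) :
    dVec d (A.mulVec v) = (A.map d).mulVec v + A.mulVec (dVec d v) := by
  funext i
  simp only [dVec, Matrix.mulVec, dotProduct, Pi.add_apply, Matrix.map_apply]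
  rw [h.sum', ← Finset.sum_add_distrib]
  exact Finset.sum_congr rfl fun j _ => h.2 _ _

theorem Nlam_map {K E : Type*} [Field K] [Field E] (ι : K →+* E) (lam : E) {l : ℕ}
    (A0 A1 : Matrix (Fin l) (Fin l) K) :
    (Nlam A0 A1).map (Polynomial.eval₂RingHom ι lam) = NlamE ι lam A0 A1 := by
  have h1 : ∀ A : Matrix (Fin l) (Fin l) K, (Polynomial.eval₂RingHom ι lam).mapMatrix
      (A.map (Polynomial.C : K →+* Polynomial K)) = A.map ι := by
    intro A; ext i j; simp
  have h2 : (Polynomial.eval₂RingHom ι lam).mapMatrix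
      ((Polynomial.X : Polynomial K) • (1 : Matrix (Fin l) (Fin l) (Polynomial K)))
      = lam • 1 := by
    ext i j
    by_cases hij : i = j <;> simp [Matrix.one_apply, hij]
  change (Polynomial.eval₂RingHom ι lam).mapMatrix (Nlam A0 A1) = _
  unfold Nlam NlamE
  rw [map_neg, map_mul, map_sub, h1, h1, h2]

theorem iter_sol {K E : Type*} [Field K] [Field E] {dK : K → K} {dE : E → E}
    (hdE : IsDeriv dE) (ι : K →+* E) (hcomp : ∀ a : K, dE (ι a) = ι (dK a))
    {lam : E} (hlam : dE lam = 0) {l : ℕ} (A0 A1 : Matrix (Fin l) (Fin l) K)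
    (ψ : Fin l → E) (hψ : dVec dE ψ = (NlamE ι lam A0 A1).mulVec ψ) (j : ℕ) :
    (dVec dE)^[j] ψ =
      ((pMat (dPoly dK) (Nlam A0 A1) j).map (Polynomial.eval₂RingHom ι lam)).mulVec ψ := by
  induction j with
  | zero =>
    have : ((1 : Matrix (Fin l) (Fin l) (Polynomial K)).map
        (Polynomial.eval₂RingHom ι lam)) = 1 :=
      map_one (Polynomial.eval₂RingHom ι lam).mapMatrix
    rw [pMat, this]; simp
  | succ j ih =>
    rw [Function.iterate_succ_apply', ih, dVec_mulVec hdE, hψ, ← Nlam_map, Matrix.mulVec_mulVec,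
      ← Matrix.add_mulVec, pMat]
    congr 1
    rw [← Matrix.map_mul, add_comm]
    ext a b
    simp only [Matrix.add_apply, Matrix.map_apply, map_add]
    rw [dPoly_eval hdE ι hcomp hlam]

/-- The matrix over `K[λ]` whose characteristic polynomial is the spectral polynomial. -/
noncomputable def G0 {K : Type*} [Field K] (dK : K → K) {l : ℕ}
    (n : ℕ) (A0 A1 : Matrix (Fin l) (Fin l) K) (Bc : ℕ → Matrix (Fin l) (Fin l) K) :
    Matrix (Fin l) (Fin l) (Polynomial K) :=
  ∑ j ∈ Finset.range (n + 1), (Bc j).map (Polynomial.C : K →+* Polynomial K) *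
    pMat (dPoly dK) (Nlam A0 A1) j

theorem fSpec_eq {K : Type*} [Field K] (dK : K → K) {l : ℕ}
    (n : ℕ) (A0 A1 : Matrix (Fin l) (Fin l) K) (Bc : ℕ → Matrix (Fin l) (Fin l) K) :
    fSpec dK n A0 A1 Bc = (-1) ^ l * (G0 dK n A0 A1 Bc).charpoly := by
  have h : Mspec dK n A0 A1 Bc = -(G0 dK n A0 A1 Bc).charmatrix := by
    unfold Mspec Matrix.charmatrix G0
    rw [map_sum, neg_sub]
    congr 1
    · refine Finset.sum_congr rfl fun j _ => ?_
      rw [map_mul]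
      congr 1
    · ext i j
      by_cases hij : i = j <;> simp [Matrix.one_apply, hij]
  unfold fSpec Matrix.charpoly
  rw [h, Matrix.det_neg]
  simp

theorem opQ_sol {K E : Type*} [Field K] [Field E] {dK : K → K} {dE : E → E}
    (hdE : IsDeriv dE) (ι : K →+* E) (hcomp : ∀ a : K, dE (ι a) = ι (dK a))
    {lam : E} (hlam : dE lam = 0) {l : ℕ} (A0 A1 : Matrix (Fin l) (Fin l) K)
    (n : ℕ) (Bc : ℕ → Matrix (Fin l) (Fin l) K)
    (ψ : Fin l → E) (hψ : dVec dE ψ = (NlamE ι lam A0 A1).mulVec ψ) :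
    opQ ι dE n Bc ψ =
      ((G0 dK n A0 A1 Bc).map (Polynomial.eval₂RingHom ι lam)).mulVec ψ := by
  change _ = ((Polynomial.eval₂RingHom ι lam).mapMatrix (G0 dK n A0 A1 Bc)).mulVec ψ
  unfold opQ G0
  rw [map_sum, Matrix.sum_mulVec]
  refine Finset.sum_congr rfl fun j _ => ?_
  rw [iter_sol hdE ι hcomp hlam A0 A1 ψ hψ, Matrix.mulVec_mulVec, map_mul]
  congr 2
  ext a b
  simp

theorem sol_iff {K E : Type*} [Field K] [Field E] (dE : E → E)
    (ι : K →+* E) (lam : E) {l : ℕ} (A0 A1 : Matrix (Fin l) (Fin l) K) (hA1 : IsUnit A1.det)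
    (ψ : Fin l → E) :
    dVec dE ψ = (NlamE ι lam A0 A1).mulVec ψ ↔ opP ι dE A0 A1 ψ = lam • ψ := by
  have e1 : A1.map ι * (A1⁻¹).map ι = 1 := by
    rw [← Matrix.map_mul, Matrix.mul_nonsing_inv _ hA1]
    exact map_one ι.mapMatrix
  have e2 : (A1⁻¹).map ι * A1.map ι = 1 := by
    rw [← Matrix.map_mul, Matrix.nonsing_inv_mul _ hA1]
    exact map_one ι.mapMatrix
  unfold opP NlamE
  constructor
  · intro h
    rw [h, Matrix.mulVec_mulVec, mul_neg, ← mul_assoc, e1, one_mul, Matrix.neg_mulVec,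
      Matrix.sub_mulVec, Matrix.smul_mulVec, Matrix.one_mulVec]
    abel
  · intro h
    have : (A1.map ι).mulVec (dVec dE ψ) = lam • ψ - (A0.map ι).mulVec ψ := by
      rw [← h]; abel
    calc dVec dE ψ = ((A1⁻¹).map ι).mulVec ((A1.map ι).mulVec (dVec dE ψ)) := by
          rw [Matrix.mulVec_mulVec, e2, Matrix.one_mulVec]
      _ = _ := by
          rw [this, Matrix.neg_mulVec, ← Matrix.mulVec_mulVec, ← Matrix.mulVec_neg]
          congr 1
          rw [Matrix.sub_mulVec, Matrix.smul_mulVec, Matrix.one_mulVec]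
          abel

theorem opQ_smul {K E : Type*} [Field K] [Field E] {dE : E → E}
    (hdE : IsDeriv dE) (ι : K →+* E) {lam : E} (hlam : dE lam = 0) {l : ℕ}
    (n : ℕ) (Bc : ℕ → Matrix (Fin l) (Fin l) K) (ψ : Fin l → E) :
    opQ ι dE n Bc (lam • ψ) = lam • opQ ι dE n Bc ψ := by
  have h : ∀ j, (dVec dE)^[j] (lam • ψ) = lam • (dVec dE)^[j] ψ := by
    intro j
    induction j with
    | zero => rfl
    | succ j ih =>
      rw [Function.iterate_succ_apply', ih, Function.iterate_succ_apply']
      funext i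
      simp [dVec, hdE.2, hlam]
  unfold opQ
  rw [Finset.smul_sum]
  refine Finset.sum_congr rfl fun j _ => ?_
  rw [h, Matrix.mulVec_smul]

theorem main_aux {K E : Type*} [Field K] [Field E]
    (dK : K → K) (dE : E → E) (hdE : IsDeriv dE)
    (ι : K →+* E) (hcomp : ∀ a : K, dE (ι a) = ι (dK a))
    (lam : E) (hlam : dE lam = 0) {l : ℕ}
    (A0 A1 : Matrix (Fin l) (Fin l) K) (hA1 : IsUnit A1.det)
    (n : ℕ) (Bc : ℕ → Matrix (Fin l) (Fin l) K)
    (hcomm : ∀ ψ : Fin l → E,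
      opP ι dE A0 A1 (opQ ι dE n Bc ψ) = opQ ι dE n Bc (opP ι dE A0 A1 ψ))
    (ψ : Fin l → E) (hψ : dVec dE ψ = (NlamE ι lam A0 A1).mulVec ψ) :
      ∑ i ∈ Finset.range (l + 1),
        Polynomial.eval₂ ι lam ((fSpec dK n A0 A1 Bc).coeff i) • (opQ ι dE n Bc)^[i] ψ = 0 := by
  set G := (G0 dK n A0 A1 Bc).map (Polynomial.eval₂RingHom ι lam) with hG
  have key : ∀ i, dVec dE ((opQ ι dE n Bc)^[i] ψ) =
      (NlamE ι lam A0 A1).mulVec ((opQ ι dE n Bc)^[i] ψ) ∧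
      (opQ ι dE n Bc)^[i] ψ = (G ^ i).mulVec ψ := by
    intro i
    induction i with
    | zero => exact ⟨hψ, by simp⟩
    | succ i ih =>
      rw [Function.iterate_succ_apply']
      refine ⟨?_, ?_⟩
      · rw [sol_iff dE ι lam A0 A1 hA1, hcomm, (sol_iff dE ι lam A0 A1 hA1 _).1 ih.1,
          opQ_smul hdE ι hlam]
      · rw [opQ_sol hdE ι hcomp hlam A0 A1 n Bc _ ih.1, ih.2, Matrix.mulVec_mulVec, pow_succ']
  have hc : ∀ i, Polynomial.eval₂ ι lam ((fSpec dK n A0 A1 Bc).coeff i)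
      = (-1) ^ l * G.charpoly.coeff i := by
    intro i
    have hm : ((-1 : Polynomial (Polynomial K)) ^ l) = Polynomial.C ((-1) ^ l) := by simp
    rw [fSpec_eq, hm, Polynomial.coeff_C_mul, ← Polynomial.coe_eval₂RingHom, map_mul, hG,
      Matrix.charpoly_map, Polynomial.coeff_map, map_pow, map_neg, map_one]
  have hCH := Matrix.aeval_self_charpoly G
  rw [Polynomial.aeval_eq_sum_range, Matrix.charpoly_natDegree_eq_dim, Fintype.card_fin] at hCH
  calc _ = ∑ i ∈ Finset.range (l + 1), (-1 : E) ^ l • (G.charpoly.coeff i • G ^ i).mulVec ψ := by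
        refine Finset.sum_congr rfl fun i _ => ?_
        rw [hc, (key i).2, Matrix.smul_mulVec, mul_smul]
    _ = 0 := by
        rw [← Finset.smul_sum, ← Matrix.sum_mulVec, hCH]
        simp

/-- Theorem 5.1: writing `f(λ,μ) = Σ_{i=0}^ℓ a_i(λ) μ^i`, the operator
`Σ_i a_i(λ) B̂^i` annihilates every solution of `ψ' = N_λ ψ`; in particular it annihilates
the columns of a fundamental matrix `Ψ` of `L - λ`. -/
theorem statement11 {K E : Type*} [Field K] [Field E] [CharZero K]
    (dK : K → K) (hdK : IsDeriv dK) (dE : E → E) (hdE : IsDeriv dE)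
    (ι : K →+* E) (hcomp : ∀ a : K, dE (ι a) = ι (dK a))
    (lam mu : E) (hlam : dE lam = 0) (hmu : dE mu = 0)
    (halg : Function.Injective (evalLM ι lam mu))
    {l : ℕ} (hl : 1 ≤ l)
    (A0 A1 : Matrix (Fin l) (Fin l) K) (hA1 : IsUnit A1.det)
    (n : ℕ) (hn : 1 ≤ n) (Bc : ℕ → Matrix (Fin l) (Fin l) K)
    (hcomm : ∀ ψ : Fin l → E,
      opP ι dE A0 A1 (opQ ι dE n Bc ψ) = opQ ι dE n Bc (opP ι dE A0 A1 ψ))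
    (Ψ : Matrix (Fin l) (Fin l) E) (hΨu : IsUnit Ψ.det)
    (hΨ : dMat dE Ψ = NlamE ι lam A0 A1 * Ψ) :
    (∀ ψ : Fin l → E, dVec dE ψ = (NlamE ι lam A0 A1).mulVec ψ →
      ∑ i ∈ Finset.range (l + 1),
        Polynomial.eval₂ ι lam ((fSpec dK n A0 A1 Bc).coeff i) • (opQ ι dE n Bc)^[i] ψ = 0)
    ∧ ∀ k : Fin l,
        ∑ i ∈ Finset.range (l + 1),
          Polynomial.eval₂ ι lam ((fSpec dK n A0 A1 Bc).coeff i) •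
            (opQ ι dE n Bc)^[i] (fun r => Ψ r k) = 0 := by
  have hmain := main_aux dK dE hdE ι hcomp lam hlam A0 A1 hA1 n Bc hcomm
  refine ⟨hmain, fun k => hmain _ ?_⟩
  funext r
  exact congrFun (congrFun hΨ r) k
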